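/- arXiv:1810.04474 — 3 statements merged into one kernel-verified Lean document; each statement's English description precedes it below -/
import Mathlib

section
/- Let K be a bounded linear operator on B_b(E). Then K is a kernel operator if and only if K is pointwise continuous, i.e. whenever (f_n) ⊂ B_b(E) is a uniformly norm-bounded sequence converging pointwise to f ∈ B_b(E), then Kf_n converges pointwise to Kf. -/
open MeasureTheory Filter Topology

variable {E : Type*}

/-- `f : E → ℝ` belongs to `B_b(E)`: it is Borel measurable and bounded. -/
def IsBddMeas [MeasurableSpace E] (f : E → ℝ) : Prop :=
  Measurable f ∧ ∃ C : ℝ, ∀ x, |f x| ≤ C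

/-- The integral of `f` against a finite signed measure, via the Jordan decomposition. -/
noncomputable def signedIntegral [MeasurableSpace E] (ν : MeasureTheory.SignedMeasure E)
    (f : E → ℝ) : ℝ :=
  (∫ y, f y ∂ν.toJordanDecomposition.posPart) - ∫ y, f y ∂ν.toJordanDecomposition.negPart

/-- `K` is a kernel operator: there is a bounded kernel `k` (a map `x ↦ k(x, ·)` into the
finite signed measures, measurable in `x` on each Borel set, with uniformly bounded total
variation) such that `(K f)(x) = ∫_E f(y) k(x, dy)` for all `f ∈ B_b(E)`, `x ∈ E`. -/
def IsKernelOperator [MeasurableSpace E] (K : (E → ℝ) → E → ℝ) : Prop :=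
  ∃ k : E → MeasureTheory.SignedMeasure E,
    (∀ A : Set E, MeasurableSet A → Measurable fun x => k x A) ∧
    (∃ C : ℝ, ∀ x, (k x).totalVariation Set.univ ≤ ENNReal.ofReal C) ∧
    ∀ f : E → ℝ, IsBddMeas f → ∀ x, K f x = signedIntegral (k x) f

section SignedIntegral

variable [MeasurableSpace E]

theorem IsBddMeas.integrable {f : E → ℝ} (hf : IsBddMeas f) (μ : Measure E) [IsFiniteMeasure μ] :
    Integrable f μ := by
  obtain ⟨hm, C, hC⟩ := hf
  exact .of_bound hm.aestronglyMeasurable C (.of_forall hC)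

theorem isBddMeas_indicator_one {A : Set E} (hA : MeasurableSet A) :
    IsBddMeas (A.indicator (fun _ => (1 : ℝ))) := by
  refine ⟨measurable_const.indicator hA, 1, fun x => ?_⟩
  by_cases h : x ∈ A <;> simp [h]

theorem isBddMeas_simpleFunc (f : SimpleFunc E ℝ) : IsBddMeas f := by
  obtain ⟨C, hC⟩ := f.exists_forall_norm_le
  exact ⟨f.measurable, C, hC⟩

theorem tendsto_signedIntegral (ν : SignedMeasure E) {fs : ℕ → E → ℝ} {f : E → ℝ}
    (hfs : ∀ n, Measurable (fs n)) {C : ℝ} (hC : ∀ n x, |fs n x| ≤ C)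
    (h : ∀ x, Tendsto (fun n => fs n x) atTop (𝓝 (f x))) :
    Tendsto (fun n => signedIntegral ν (fs n)) atTop (𝓝 (signedIntegral ν f)) := by
  have key (μ : Measure E) [IsFiniteMeasure μ] :
      Tendsto (fun n => ∫ y, fs n y ∂μ) atTop (𝓝 (∫ y, f y ∂μ)) :=
    tendsto_integral_of_dominated_convergence (fun _ => C)
      (fun n => (hfs n).aestronglyMeasurable) (integrable_const C)
      (fun n => .of_forall (hC n)) (.of_forall h)
  exact (key _).sub (key _)

theorem signedIntegral_add (ν : SignedMeasure E) {f g : E → ℝ} (hf : IsBddMeas f)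
    (hg : IsBddMeas g) : signedIntegral ν (f + g) = signedIntegral ν f + signedIntegral ν g := by
  simp only [signedIntegral, Pi.add_apply]
  rw [integral_add (hf.integrable _) (hg.integrable _),
    integral_add (hf.integrable _) (hg.integrable _)]
  ring

theorem signedIntegral_smul (ν : SignedMeasure E) (c : ℝ) (f : E → ℝ) :
    signedIntegral ν (c • f) = c * signedIntegral ν f := by
  simp only [signedIntegral, Pi.smul_apply, smul_eq_mul, integral_const_mul]
  ring

theorem signedMeasure_apply_eq_sub (ν : SignedMeasure E) {A : Set E} (hA : MeasurableSet A) :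
    ν A = ν.toJordanDecomposition.posPart.real A - ν.toJordanDecomposition.negPart.real A := by
  conv_lhs => rw [← ν.toSignedMeasure_toJordanDecomposition]
  simp [JordanDecomposition.toSignedMeasure, Measure.toSignedMeasure_apply_measurable hA]

theorem signedIntegral_indicator_one (ν : SignedMeasure E) {A : Set E} (hA : MeasurableSet A) :
    signedIntegral ν (A.indicator fun _ => (1 : ℝ)) = ν A := by
  rw [signedMeasure_apply_eq_sub ν hA, signedIntegral, integral_indicator_const _ hA,
    integral_indicator_const _ hA]
  simp

theorem totalVariation_univ_le (ν : SignedMeasure E) {C : ℝ}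
    (h : ∀ A, MeasurableSet A → |ν A| ≤ C) :
    ν.totalVariation Set.univ ≤ ENNReal.ofReal (2 * C) := by
  obtain ⟨u, hu, hp, hn⟩ := ν.toJordanDecomposition.mutuallySingular
  have hpos := signedMeasure_apply_eq_sub ν hu.compl
  have hneg := signedMeasure_apply_eq_sub ν hu
  have hpc := measureReal_add_measureReal_compl (μ := ν.toJordanDecomposition.posPart) hu
  have hnc := measureReal_add_measureReal_compl (μ := ν.toJordanDecomposition.negPart) hu
  rw [measureReal_def, hp, ENNReal.toReal_zero] at hneg hpc
  rw [measureReal_def _ uᶜ, hn, ENNReal.toReal_zero] at hnc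
  rw [measureReal_def _ uᶜ, measureReal_def _ uᶜ, hn, ENNReal.toReal_zero] at hpos
  rw [measureReal_def] at hpc
  have h1 := (abs_le.1 (h _ hu.compl)).2
  have h2 := (abs_le.1 (h _ hu)).1
  rw [SignedMeasure.totalVariation, Measure.add_apply, ← ofReal_measureReal, ← ofReal_measureReal,
    ← ENNReal.ofReal_add measureReal_nonneg measureReal_nonneg]
  apply ENNReal.ofReal_le_ofReal
  linarith

/-- `L` is a linear functional on the bounded measurable functions which is sequentially continuous
under uniformly bounded pointwise convergence. -/
structure IsBddPointwiseFunctional (L : (E → ℝ) → ℝ) : Prop where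
  map_add : ∀ f g, IsBddMeas f → IsBddMeas g → L (f + g) = L f + L g
  map_smul : ∀ (c : ℝ) f, IsBddMeas f → L (c • f) = c * L f
  tendsto : ∀ (fs : ℕ → E → ℝ) (f : E → ℝ), (∀ n, IsBddMeas (fs n)) → IsBddMeas f →
    (∃ C : ℝ, ∀ n x, |fs n x| ≤ C) → (∀ x, Tendsto (fun n => fs n x) atTop (𝓝 (f x))) →
    Tendsto (fun n => L (fs n)) atTop (𝓝 (L f))

namespace IsBddPointwiseFunctional

variable {L : (E → ℝ) → ℝ}

theorem indicator_biUnion (hL : IsBddPointwiseFunctional L) {A : ℕ → Set E}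
    (hA : ∀ i, MeasurableSet (A i)) (hd : Pairwise (Function.onFun Disjoint A)) (s : Finset ℕ) :
    L ((⋃ i ∈ s, A i).indicator fun _ => 1) = ∑ i ∈ s, L ((A i).indicator fun _ => 1) := by
  classical
  induction s using Finset.induction_on with
  | empty =>
    have h := hL.map_smul 0 ((∅ : Set E).indicator fun _ => 1) (isBddMeas_indicator_one .empty)
    simp only [Set.indicator_empty, zero_mul] at h
    simpa [← Pi.zero_def] using h
  | insert a s ha ih =>
    have hdis : Disjoint (A a) (⋃ i ∈ s, A i) := by
      simp only [Set.disjoint_iUnion_right]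
      exact fun i hi => hd (by rintro rfl; exact ha hi)
    rw [Finset.sum_insert ha, ← ih, ← hL.map_add _ _ (isBddMeas_indicator_one (hA a))
      (isBddMeas_indicator_one (s.measurableSet_biUnion fun i _ => hA i)),
      Finset.set_biUnion_insert, Set.indicator_union_of_disjoint hdis]
    rfl

theorem hasSum_indicator (hL : IsBddPointwiseFunctional L) {A : ℕ → Set E}
    (hA : ∀ i, MeasurableSet (A i)) (hd : Pairwise (Function.onFun Disjoint A)) :
    HasSum (fun i => L ((A i).indicator fun _ => 1)) (L ((⋃ i, A i).indicator fun _ => 1)) := by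
  refine tendsto_of_seq_tendsto fun u hu => ?_
  simp only [Function.comp_def, ← hL.indicator_biUnion hA hd]
  refine hL.tendsto _ _
    (fun n => isBddMeas_indicator_one ((u n).measurableSet_biUnion fun i _ => hA i))
    (isBddMeas_indicator_one (.iUnion hA)) ⟨1, fun n x => ?_⟩ fun x => ?_
  · by_cases h : x ∈ ⋃ i ∈ u n, A i <;> simp only [Set.indicator, h] <;> simp
  · by_cases hx : x ∈ ⋃ i, A i
    · obtain ⟨i, hi⟩ := Set.mem_iUnion.1 hx
      refine tendsto_const_nhds.congr' ?_
      filter_upwards [hu.eventually (eventually_ge_atTop {i})] with n hn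
      rw [Set.indicator_of_mem hx,
        Set.indicator_of_mem (Set.mem_iUnion₂.2 ⟨i, Finset.singleton_subset_iff.1 hn, hi⟩)]
    · refine tendsto_const_nhds.congr fun n => ?_
      rw [Set.indicator_of_notMem hx, Set.indicator_of_notMem]
      exact fun h => hx (Set.iUnion₂_subset_iUnion _ _ h)

open Classical in
/-- The signed measure `A ↦ L 1_A` of a linear, boundedly pointwise continuous functional. -/
noncomputable def toSignedMeasure (hL : IsBddPointwiseFunctional L) : SignedMeasure E where
  measureOf' A := if MeasurableSet A then L (A.indicator fun _ => 1) else 0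
  empty' := by
    rw [if_pos .empty]
    simpa using hL.indicator_biUnion (A := fun _ => ∅) (fun _ => .empty)
      (fun _ _ _ => disjoint_bot_left) ∅
  not_measurable' _ hA := if_neg hA
  m_iUnion' A hA hd := by
    simpa only [hA, MeasurableSet.iUnion hA, if_true] using hL.hasSum_indicator hA hd

theorem toSignedMeasure_apply (hL : IsBddPointwiseFunctional L) {A : Set E}
    (hA : MeasurableSet A) : hL.toSignedMeasure A = L (A.indicator fun _ => 1) :=
  if_pos hA

theorem eq_signedIntegral (hL : IsBddPointwiseFunctional L) {f : E → ℝ} (hf : IsBddMeas f) :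
    L f = signedIntegral hL.toSignedMeasure f := by
  have hsimple (g : SimpleFunc E ℝ) : L g = signedIntegral hL.toSignedMeasure g := by
    induction g using SimpleFunc.induction with
    | const c hs =>
      rename_i s
      have h : ⇑((SimpleFunc.const E c).piecewise s hs (SimpleFunc.const E 0)) =
          c • s.indicator fun _ => (1 : ℝ) := by
        ext x
        by_cases hx : x ∈ s <;> simp [hx]
      rw [h, hL.map_smul _ _ (isBddMeas_indicator_one hs), signedIntegral_smul,
        signedIntegral_indicator_one _ hs, hL.toSignedMeasure_apply hs]
    | add _ hf hg =>
      rw [SimpleFunc.coe_add, hL.map_add _ _ (isBddMeas_simpleFunc _) (isBddMeas_simpleFunc _),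
        signedIntegral_add _ (isBddMeas_simpleFunc _) (isBddMeas_simpleFunc _), hf, hg]
  obtain ⟨C, hC⟩ := hf.2
  have hsm := hf.1.stronglyMeasurable
  have hbound (n : ℕ) (x : E) : |hsm.approxBounded |C| n x| ≤ |C| :=
    hsm.norm_approxBounded_le (abs_nonneg C) n x
  have hlim (x : E) : Tendsto (fun n => hsm.approxBounded |C| n x) atTop (𝓝 (f x)) :=
    hsm.tendsto_approxBounded_of_norm_le ((hC x).trans (le_abs_self C))
  have h := hL.tendsto (fun n => hsm.approxBounded |C| n) f (fun n => isBddMeas_simpleFunc _) hf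
    ⟨_, hbound⟩ hlim
  simp only [hsimple] at h
  exact tendsto_nhds_unique h
    (tendsto_signedIntegral _ (fun n => SimpleFunc.measurable _) hbound hlim)

end IsBddPointwiseFunctional

end SignedIntegral

/-- Let `E` be a complete separable metric space and let `K` be a bounded
linear operator on `B_b(E)`. Then `K` is a kernel operator if and only if `K` is pointwise
continuous: whenever `(fₙ) ⊂ B_b(E)` is a uniformly norm-bounded sequence converging
pointwise to `f ∈ B_b(E)`, then `K fₙ` converges pointwise to `K f`. -/
theorem isKernelOperator_iff_pointwise_continuous
    [MetricSpace E] [CompleteSpace E] [TopologicalSpace.SeparableSpace E]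
    [MeasurableSpace E] [BorelSpace E]
    (K : (E → ℝ) → E → ℝ)
    (hmaps : ∀ f, IsBddMeas f → IsBddMeas (K f))
    (hadd : ∀ f g, IsBddMeas f → IsBddMeas g → K (f + g) = K f + K g)
    (hsmul : ∀ (c : ℝ) f, IsBddMeas f → K (c • f) = c • K f)
    (hbdd : ∃ C : ℝ, ∀ f : E → ℝ, ∀ M : ℝ, IsBddMeas f → (∀ x, |f x| ≤ M) →
      ∀ x, |K f x| ≤ C * M) :
    IsKernelOperator K ↔
      ∀ (fs : ℕ → E → ℝ) (f : E → ℝ),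
        (∀ n, IsBddMeas (fs n)) → IsBddMeas f →
        (∃ C : ℝ, ∀ n x, |fs n x| ≤ C) →
        (∀ x, Filter.Tendsto (fun n => fs n x) Filter.atTop (nhds (f x))) →
        ∀ x, Filter.Tendsto (fun n => K (fs n) x) Filter.atTop (nhds (K f x)) := by
  constructor
  · rintro ⟨k, -, -, hk⟩ fs f hfs hf ⟨C, hC⟩ h x
    simp only [hk _ hf, fun n => hk _ (hfs n)]
    exact tendsto_signedIntegral _ (fun n => (hfs n).1) hC h
  · intro hcont
    have hL (x : E) : IsBddPointwiseFunctional fun f => K f x :=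
      { map_add := fun f g hf hg => congrFun (hadd f g hf hg) x
        map_smul := fun c f hf => congrFun (hsmul c f hf) x
        tendsto := fun fs f hfs hf hC h => hcont fs f hfs hf hC h x }
    refine ⟨fun x => (hL x).toSignedMeasure, fun A hA => ?_, ?_,
      fun f hf x => (hL x).eq_signedIntegral hf⟩
    · simp only [fun x => (hL x).toSignedMeasure_apply hA]
      exact (hmaps _ (isBddMeas_indicator_one hA)).1
    · obtain ⟨C, hC⟩ := hbdd
      refine ⟨2 * (C * 1), fun x => totalVariation_univ_le _ fun A hA => ?_⟩
      rw [(hL x).toSignedMeasure_apply hA]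
      refine hC _ 1 (isBddMeas_indicator_one hA) (fun y => ?_) x
      by_cases h : y ∈ A <;> simp [h]
end

section
/- Let K be a strong Feller operator on L∞(E,m). Then K is an adjoint operator: there exists a bounded linear operator S on L¹(E,m) with K = S*; equivalently, for every x ∈ E there exists g_x ∈ L¹(E,m) such that (Kf)(x) = ∫_E f g_x dm for all f ∈ L∞(E,m), and K is (sequentially) weak*-continuous. -/
open MeasureTheory Filter Topology

variable {E : Type*}

/-- The duality pairing `(f, g) ↦ ∫ f g dm` between `L∞(m)` and `L¹(m)`. -/
noncomputable def linftyPairing {α : Type*} [MeasurableSpace α] (m : Measure α) :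
    Lp ℝ ⊤ m →L[ℝ] Lp ℝ 1 m →L[ℝ] ℝ :=
  (ContinuousLinearMap.mul ℝ ℝ).lpPairing m ⊤ 1

lemma linftyPairing_apply {α : Type*} [MeasurableSpace α] {m : Measure α}
    (f : Lp ℝ ⊤ m) (g : Lp ℝ 1 m) :
    linftyPairing m f g = ∫ x, (f : α → ℝ) x * (g : α → ℝ) x ∂m := by
  simp [linftyPairing, ContinuousLinearMap.lpPairing_eq_integral]

lemma Lp_top_norm_le_of_ae_bound {α : Type*} [MeasurableSpace α] {m : Measure α}
    {f : Lp ℝ ⊤ m} {C : ℝ} (hC : 0 ≤ C) (h : ∀ᵐ x ∂m, ‖(f : α → ℝ) x‖ ≤ C) : ‖f‖ ≤ C := by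
  rw [Lp.norm_def, eLpNorm_exponent_top]
  exact ENNReal.toReal_le_of_le_ofReal hC (eLpNormEssSup_le_of_ae_bound h)

lemma Lp_top_ae_norm_le {α : Type*} [MeasurableSpace α] {m : Measure α} (f : Lp ℝ ⊤ m) :
    ∀ᵐ x ∂m, ‖(f : α → ℝ) x‖ ≤ ‖f‖ := by
  filter_upwards [ae_le_eLpNormEssSup (f := (f : α → ℝ)) (μ := m)] with x hx
  rw [← eLpNorm_exponent_top, ← Lp.enorm_def] at hx
  simpa [enorm_le_iff_norm_le] using hx

/-- Every `g ∈ L¹` is normed by its sign. -/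
lemma exists_linftyPairing_eq_norm {α : Type*} [MeasurableSpace α] {m : Measure α}
    (g : Lp ℝ 1 m) : ∃ f : Lp ℝ ⊤ m, ‖f‖ ≤ 1 ∧ linftyPairing m f g = ‖g‖ := by
  have hs : Measurable fun x => if 0 ≤ (g : α → ℝ) x then (1 : ℝ) else -1 :=
    Measurable.ite (measurableSet_le measurable_const (Lp.stronglyMeasurable g).measurable)
      measurable_const measurable_const
  have hb : ∀ x, ‖if 0 ≤ (g : α → ℝ) x then (1 : ℝ) else -1‖ ≤ 1 := fun x => by
    split_ifs <;> simp
  have hL : MemLp (fun x => if 0 ≤ (g : α → ℝ) x then (1 : ℝ) else -1) ⊤ m :=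
    memLp_top_of_bound hs.aestronglyMeasurable 1 (.of_forall hb)
  refine ⟨hL.toLp _, Lp_top_norm_le_of_ae_bound zero_le_one ?_, ?_⟩
  · filter_upwards [hL.coeFn_toLp] with x hx
    rw [hx]
    exact hb x
  · rw [linftyPairing_apply, L1.norm_eq_integral_norm]
    refine integral_congr_ae ?_
    filter_upwards [hL.coeFn_toLp] with x hx
    rw [hx, Real.norm_eq_abs]
    split_ifs with h
    · rw [one_mul, abs_of_nonneg h]
    · rw [neg_one_mul, abs_of_neg (not_le.mp h)]

lemma linftyPairing_right_injective {α : Type*} [MeasurableSpace α] {m : Measure α}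
    {g₁ g₂ : Lp ℝ 1 m} (h : ∀ f, linftyPairing m f g₁ = linftyPairing m f g₂) : g₁ = g₂ := by
  obtain ⟨f, -, hf⟩ := exists_linftyPairing_eq_norm (g₁ - g₂)
  rw [map_sub, h, sub_self] at hf
  exact sub_eq_zero.mp (norm_eq_zero.mp hf.symm)

/-- The pairing with a fixed `g ∈ L¹` is continuous along bounded a.e. convergent sequences. -/
lemma tendsto_linftyPairing_of_ae_tendsto {α : Type*} [MeasurableSpace α] {m : Measure α}
    (g : Lp ℝ 1 m) {fs : ℕ → Lp ℝ ⊤ m} {f : Lp ℝ ⊤ m} {C : ℝ} (hC : ∀ n, ‖fs n‖ ≤ C)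
    (h : ∀ᵐ x ∂m, Tendsto (fun n => (fs n : α → ℝ) x) atTop (𝓝 ((f : α → ℝ) x))) :
    Tendsto (fun n => linftyPairing m (fs n) g) atTop (𝓝 (linftyPairing m f g)) := by
  simp only [linftyPairing_apply]
  refine tendsto_integral_of_dominated_convergence (fun x => C * ‖(g : α → ℝ) x‖)
    (fun n => (Lp.aestronglyMeasurable _).mul (Lp.aestronglyMeasurable _))
    ((L1.integrable_coeFn g).norm.const_mul C) (fun n => ?_) ?_
  · filter_upwards [Lp_top_ae_norm_le (fs n)] with x hx
    rw [norm_mul]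
    gcongr
    exact hx.trans (hC n)
  · filter_upwards [h] with x hx
    exact hx.mul_const _

/-- The class in `L∞` of the indicator function of a measurable set (and `0` for other sets). -/
noncomputable def linftyIndicator {α : Type*} [MeasurableSpace α] (m : Measure α) (A : Set α) :
    Lp ℝ ⊤ m :=
  open Classical in
  if hA : MeasurableSet A then
    ((memLp_top_const (1 : ℝ)).indicator hA : MemLp (A.indicator fun _ => (1 : ℝ)) ⊤ m).toLp _
  else 0

lemma linftyIndicator_coeFn {α : Type*} [MeasurableSpace α] (m : Measure α) {A : Set α}
    (hA : MeasurableSet A) :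
    (linftyIndicator m A : α → ℝ) =ᵐ[m] A.indicator fun _ => (1 : ℝ) := by
  rw [linftyIndicator, dif_pos hA]
  exact MemLp.coeFn_toLp _

lemma norm_linftyIndicator_le {α : Type*} [MeasurableSpace α] (m : Measure α) {A : Set α}
    (hA : MeasurableSet A) : ‖linftyIndicator m A‖ ≤ 1 := by
  refine Lp_top_norm_le_of_ae_bound zero_le_one ?_
  filter_upwards [linftyIndicator_coeFn m hA] with x hx
  rw [hx]
  by_cases h : x ∈ A <;> simp [h]

lemma linftyIndicator_of_measure_zero {α : Type*} [MeasurableSpace α] {m : Measure α} {A : Set α}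
    (hA : m A = 0) : linftyIndicator m A = 0 := by
  by_cases hm : MeasurableSet A
  · refine Lp.ext ?_
    filter_upwards [linftyIndicator_coeFn m hm, Lp.coeFn_zero ℝ ⊤ m,
      measure_eq_zero_iff_ae_notMem.mp hA] with x h1 h2 h3
    rw [h1, h2]
    simp [h3]
  · rw [linftyIndicator, dif_neg hm]

lemma linftyIndicator_union {α : Type*} [MeasurableSpace α] (m : Measure α) {A B : Set α}
    (hA : MeasurableSet A) (hB : MeasurableSet B) (hAB : Disjoint A B) :
    linftyIndicator m (A ∪ B) = linftyIndicator m A + linftyIndicator m B := by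
  refine Lp.ext ?_
  filter_upwards [linftyIndicator_coeFn m (hA.union hB), linftyIndicator_coeFn m hA,
    linftyIndicator_coeFn m hB, Lp.coeFn_add (linftyIndicator m A) (linftyIndicator m B)]
    with x h1 h2 h3 h4
  rw [h1, h4, Pi.add_apply, h2, h3, Set.indicator_union_of_disjoint hAB]

lemma linftyIndicator_biUnion {α ι : Type*} [MeasurableSpace α] (m : Measure α) {A : ι → Set α}
    (hA : ∀ i, MeasurableSet (A i)) (hd : Pairwise (Function.onFun Disjoint A)) (s : Finset ι) :
    linftyIndicator m (⋃ i ∈ s, A i) = ∑ i ∈ s, linftyIndicator m (A i) := by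
  classical
  induction s using Finset.induction_on with
  | empty => simp [linftyIndicator_of_measure_zero]
  | insert a s ha ih =>
    rw [Finset.set_biUnion_insert, Finset.sum_insert ha, ← ih]
    refine linftyIndicator_union m (hA a) (s.measurableSet_biUnion fun i _ => hA i) ?_
    refine Set.disjoint_iUnion₂_right.mpr fun i hi => hd ?_
    rintro rfl
    exact ha hi

/-- A linear functional on `L∞` which is continuous along bounded a.e. convergent sequences
induces a signed measure. -/
noncomputable def signedMeasureOfFunctional {α : Type*} [MeasurableSpace α] {m : Measure α}
    (φ : Lp ℝ ⊤ m →ₗ[ℝ] ℝ)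
    (hφ : ∀ (fs : ℕ → Lp ℝ ⊤ m) (f : Lp ℝ ⊤ m), (∃ C : ℝ, ∀ n, ‖fs n‖ ≤ C) →
      (∀ᵐ x ∂m, Tendsto (fun n => (fs n : α → ℝ) x) atTop (𝓝 ((f : α → ℝ) x))) →
      Tendsto (fun n => φ (fs n)) atTop (𝓝 (φ f))) : SignedMeasure α where
  measureOf' A := φ (linftyIndicator m A)
  empty' := by rw [linftyIndicator_of_measure_zero measure_empty, map_zero]
  not_measurable' A hA := by rw [linftyIndicator, dif_neg hA, map_zero]
  m_iUnion' A hA hd := by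
    refine tendsto_of_seq_tendsto fun u hu => ?_
    simp only [SummationFilter.unconditional_filter] at hu
    have hmeas : ∀ s : Finset ℕ, MeasurableSet (⋃ i ∈ s, A i) := fun s =>
      s.measurableSet_biUnion fun i _ => hA i
    have key := hφ (fun n => linftyIndicator m (⋃ i ∈ u n, A i)) (linftyIndicator m (⋃ i, A i))
      ⟨1, fun n => norm_linftyIndicator_le m (hmeas _)⟩ (by
        filter_upwards [linftyIndicator_coeFn m (MeasurableSet.iUnion hA),
          ae_all_iff.mpr fun n => linftyIndicator_coeFn m (hmeas (u n))] with x h1 h2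
        simp only [h1, h2]
        refine tendsto_nhds_of_eventually_eq ?_
        by_cases hx : x ∈ ⋃ i, A i
        · obtain ⟨i, hi⟩ := Set.mem_iUnion.mp hx
          filter_upwards [hu (Filter.mem_atTop {i})] with n hn
          have hin : i ∈ u n := by simpa using hn
          rw [Set.indicator_of_mem hx, Set.indicator_of_mem (Set.mem_iUnion₂_of_mem hin hi)]
        · refine .of_forall fun n => ?_
          rw [Set.indicator_of_notMem hx, Set.indicator_of_notMem]
          exact fun h => hx (Set.iUnion₂_subset_iUnion _ _ h))
    simpa only [linftyIndicator_biUnion m hA hd, map_sum, Function.comp_def] using key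

/-- Linear functionals on `L∞` which are continuous along bounded a.e. convergent sequences are
represented by elements of `L¹`. -/
lemma exists_linftyPairing_eq {α : Type*} [MeasurableSpace α] {m : Measure α} [SigmaFinite m]
    (φ : Lp ℝ ⊤ m →ₗ[ℝ] ℝ)
    (hφ : ∀ (fs : ℕ → Lp ℝ ⊤ m) (f : Lp ℝ ⊤ m), (∃ C : ℝ, ∀ n, ‖fs n‖ ≤ C) →
      (∀ᵐ x ∂m, Tendsto (fun n => (fs n : α → ℝ) x) atTop (𝓝 ((f : α → ℝ) x))) →
      Tendsto (fun n => φ (fs n)) atTop (𝓝 (φ f))) :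
    ∃ g : Lp ℝ 1 m, ∀ f, φ f = linftyPairing m f g := by
  set ν : SignedMeasure α := signedMeasureOfFunctional φ hφ
  have hac : ν ≪ᵥ m.toENNRealVectorMeasure := by
    refine VectorMeasure.AbsolutelyContinuous.mk fun A hA h => ?_
    rw [Measure.toENNRealVectorMeasure_apply_measurable hA] at h
    change φ (linftyIndicator m A) = 0
    rw [linftyIndicator_of_measure_zero h, map_zero]
  have hint : Integrable (ν.rnDeriv m) m := SignedMeasure.integrable_rnDeriv ν m
  have hdens := SignedMeasure.withDensityᵥ_rnDeriv_eq ν m hac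
  have hind : ∀ A, MeasurableSet A → φ (linftyIndicator m A) =
      linftyPairing m (linftyIndicator m A) (hint.toL1 _) := fun A hA => by
    have h1 : m.withDensityᵥ (ν.rnDeriv m) A = φ (linftyIndicator m A) := by rw [hdens]; rfl
    rw [← h1, withDensityᵥ_apply hint hA, linftyPairing_apply, ← integral_indicator hA]
    refine integral_congr_ae ?_
    filter_upwards [linftyIndicator_coeFn m hA, hint.coeFn_toL1] with x h2 h3
    rw [h2, h3]
    by_cases hx : x ∈ A <;> simp [hx]
  have hsimple : ∀ s : SimpleFunc α ℝ, φ ((s.memLp_top m).toLp s) =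
      linftyPairing m ((s.memLp_top m).toLp s) (hint.toL1 _) := fun s => by
    induction s using SimpleFunc.induction with
    | @const c A hA =>
      have heq : ((SimpleFunc.piecewise A hA (.const α c) (.const α 0)).memLp_top m).toLp _ =
          c • linftyIndicator m A := by
        refine Lp.ext ?_
        filter_upwards [MemLp.coeFn_toLp
          ((SimpleFunc.piecewise A hA (.const α c) (.const α 0)).memLp_top m),
          linftyIndicator_coeFn m hA, Lp.coeFn_smul c (linftyIndicator m A)] with x h1 h2 h3
        rw [h1, h3, Pi.smul_apply, h2]
        by_cases hx : x ∈ A <;> simp [hx]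
      rw [heq, map_smul, map_smul, hind A hA]
      rfl
    | @add f g _ hf hg =>
      have heq : ((f + g).memLp_top m).toLp _ =
          (f.memLp_top m).toLp _ + (g.memLp_top m).toLp _ := rfl
      rw [heq, map_add, map_add, hf, hg]
      rfl
  refine ⟨hint.toL1 _, fun f => ?_⟩
  have hsm := Lp.stronglyMeasurable f
  have hle := hsm.norm_approxBounded_le (norm_nonneg f)
  have hbound : ∀ n, ‖((hsm.approxBounded ‖f‖ n).memLp_top m).toLp _‖ ≤ ‖f‖ := fun n => by
    refine Lp_top_norm_le_of_ae_bound (norm_nonneg f) ?_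
    filter_upwards [MemLp.coeFn_toLp ((hsm.approxBounded ‖f‖ n).memLp_top m)] with x hx
    rw [hx]
    exact hle n x
  have hae : ∀ᵐ x ∂m, Tendsto
      (fun n => (((hsm.approxBounded ‖f‖ n).memLp_top m).toLp _ : α → ℝ) x) atTop
      (𝓝 ((f : α → ℝ) x)) := by
    filter_upwards [hsm.tendsto_approxBounded_ae (Lp_top_ae_norm_le f), ae_all_iff.mpr fun n =>
      MemLp.coeFn_toLp ((hsm.approxBounded ‖f‖ n).memLp_top m)] with x h1 h2
    simpa only [h2] using h1
  refine tendsto_nhds_unique (hφ _ f ⟨_, hbound⟩ hae) ?_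
  simp only [hsimple]
  exact tendsto_linftyPairing_of_ae_tendsto _ hbound hae

/-- A bounded operator on `L∞` which is continuous along bounded sequences for a.e. convergence
is the adjoint of a bounded operator on `L¹`. -/
lemma exists_preadjoint {α : Type*} [MeasurableSpace α] {m : Measure α} [SigmaFinite m]
    (K : Lp ℝ ⊤ m →L[ℝ] Lp ℝ ⊤ m)
    (hK : ∀ (fs : ℕ → Lp ℝ ⊤ m) (f : Lp ℝ ⊤ m), (∃ C : ℝ, ∀ n, ‖fs n‖ ≤ C) →
      (∀ᵐ x ∂m, Tendsto (fun n => (fs n : α → ℝ) x) atTop (𝓝 ((f : α → ℝ) x))) →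
      ∀ᵐ x ∂m, Tendsto (fun n => (K (fs n) : α → ℝ) x) atTop (𝓝 ((K f : α → ℝ) x))) :
    ∃ S : Lp ℝ 1 m →L[ℝ] Lp ℝ 1 m, ∀ f g,
      linftyPairing m (K f) g = linftyPairing m f (S g) := by
  have hex : ∀ g : Lp ℝ 1 m, ∃ h : Lp ℝ 1 m, ∀ f,
      linftyPairing m (K f) g = linftyPairing m f h := fun g =>
    exists_linftyPairing_eq (((linftyPairing m).flip g ∘L K : Lp ℝ ⊤ m →L[ℝ] ℝ) : _ →ₗ[ℝ] ℝ)
      fun fs f ⟨C, hC⟩ h =>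
        tendsto_linftyPairing_of_ae_tendsto g (C := ‖K‖ * C)
          (fun n => (K.le_opNorm _).trans (by gcongr; exact hC n)) (hK fs f ⟨C, hC⟩ h)
  choose S hS using hex
  let T : Lp ℝ 1 m →ₗ[ℝ] Lp ℝ 1 m :=
    { toFun := S
      map_add' := fun g₁ g₂ => linftyPairing_right_injective fun f => by
        rw [← hS, map_add, map_add, hS, hS]
      map_smul' := fun c g => linftyPairing_right_injective fun f => by
        rw [← hS, map_smul, RingHom.id_apply, map_smul, hS] }
  refine ⟨T.mkContinuous (‖linftyPairing m‖ * ‖K‖) fun g => ?_, fun f g => hS g f⟩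
  obtain ⟨f, hf, hfg⟩ := exists_linftyPairing_eq_norm (S g)
  calc ‖S g‖ = linftyPairing m (K f) g := by rw [hS, hfg]
    _ ≤ ‖linftyPairing m (K f) g‖ := le_abs_self _
    _ ≤ ‖linftyPairing m‖ * ‖K f‖ * ‖g‖ := (linftyPairing m).le_opNorm₂ _ _
    _ ≤ ‖linftyPairing m‖ * ‖K‖ * ‖g‖ := by
      gcongr
      exact (K.le_opNorm f).trans (mul_le_of_le_one_right (norm_nonneg K) hf)

/-- Let `E` be a Polish space and `m` a σ-finite Borel measure with full
support. Let `K` be a strong Feller operator on `L∞(E, m)`: every `K f` has a bounded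
continuous representative `Kc f`, and for every norm-bounded sequence `(fₙ)` converging
`m`-a.e. to `f` one has `(K fₙ)(x) → (K f)(x)` for every `x`. Then `K` is an adjoint
operator: there is `S : L¹(E, m) → L¹(E, m)` bounded linear with `K = S*`; equivalently,
for every `x ∈ E` there is `g_x ∈ L¹(E, m)` with `(K f)(x) = ∫ f g_x dm` for all
`f ∈ L∞(E, m)`, and `K` is sequentially weak*-continuous. -/
theorem strongFeller_is_adjoint
    [MetricSpace E] [CompleteSpace E] [TopologicalSpace.SeparableSpace E]
    [MeasurableSpace E] [BorelSpace E]
    (m : MeasureTheory.Measure E) [MeasureTheory.SigmaFinite m]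
    (hfull : ∀ (x : E) (r : ℝ), 0 < r → 0 < m (Metric.ball x r))
    (K : MeasureTheory.Lp ℝ ⊤ m →L[ℝ] MeasureTheory.Lp ℝ ⊤ m)
    (Kc : MeasureTheory.Lp ℝ ⊤ m → BoundedContinuousFunction E ℝ)
    (hKc : ∀ f : MeasureTheory.Lp ℝ ⊤ m, (K f : E → ℝ) =ᵐ[m] (Kc f : E → ℝ))
    (hsf : ∀ (fs : ℕ → MeasureTheory.Lp ℝ ⊤ m) (f : MeasureTheory.Lp ℝ ⊤ m),
      (∃ C : ℝ, ∀ n, ‖fs n‖ ≤ C) →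
      (∀ᵐ x ∂m, Filter.Tendsto (fun n => (fs n : E → ℝ) x) Filter.atTop
        (nhds ((f : E → ℝ) x))) →
      ∀ x, Filter.Tendsto (fun n => Kc (fs n) x) Filter.atTop (nhds (Kc f x))) :
    (∃ S : MeasureTheory.Lp ℝ 1 m →L[ℝ] MeasureTheory.Lp ℝ 1 m,
      ∀ (f : MeasureTheory.Lp ℝ ⊤ m) (g : MeasureTheory.Lp ℝ 1 m),
        (∫ x, (K f : E → ℝ) x * (g : E → ℝ) x ∂m)
          = ∫ x, (f : E → ℝ) x * (S g : E → ℝ) x ∂m) ∧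
    (∀ x : E, ∃ g : MeasureTheory.Lp ℝ 1 m, ∀ f : MeasureTheory.Lp ℝ ⊤ m,
      Kc f x = ∫ y, (f : E → ℝ) y * (g : E → ℝ) y ∂m) ∧
    (∀ (fs : ℕ → MeasureTheory.Lp ℝ ⊤ m) (f : MeasureTheory.Lp ℝ ⊤ m),
      (∀ g : MeasureTheory.Lp ℝ 1 m,
        Filter.Tendsto (fun n => ∫ x, (fs n : E → ℝ) x * (g : E → ℝ) x ∂m) Filter.atTop
          (nhds (∫ x, (f : E → ℝ) x * (g : E → ℝ) x ∂m))) →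
      ∀ g : MeasureTheory.Lp ℝ 1 m,
        Filter.Tendsto (fun n => ∫ x, (K (fs n) : E → ℝ) x * (g : E → ℝ) x ∂m) Filter.atTop
          (nhds (∫ x, (K f : E → ℝ) x * (g : E → ℝ) x ∂m))) := by
  have hopen : m.IsOpenPosMeasure := ⟨fun U hU ⟨x, hx⟩ h0 => by
    obtain ⟨r, hr, hball⟩ := Metric.isOpen_iff.mp hU x hx
    exact (hfull x r hr).ne' (measure_mono_null hball h0)⟩
  obtain ⟨S, hS⟩ := exists_preadjoint K fun fs f hb h => by
    filter_upwards [hKc f, ae_all_iff.mpr fun n => hKc (fs n)] with x h1 h2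
    simpa only [h1, h2] using hsf fs f hb h x
  have hadd : ∀ f₁ f₂, Kc (f₁ + f₂) = Kc f₁ + Kc f₂ := fun f₁ f₂ => DFunLike.coe_injective <|
    Measure.eq_of_ae_eq (μ := m) (by
      filter_upwards [hKc f₁, hKc f₂, hKc (f₁ + f₂), Lp.coeFn_add (K f₁) (K f₂)]
        with x h1 h2 h3 h4
      rw [← h3, map_add, h4]
      simp [h1, h2]) (map_continuous _) (map_continuous _)
  have hsmul : ∀ (c : ℝ) f, Kc (c • f) = c • Kc f := fun c f => DFunLike.coe_injective <|
    Measure.eq_of_ae_eq (μ := m) (by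
      filter_upwards [hKc f, hKc (c • f), Lp.coeFn_smul c (K f)] with x h1 h2 h3
      rw [← h2, map_smul, h3]
      simp [h1]) (map_continuous _) (map_continuous _)
  simp only [← linftyPairing_apply]
  refine ⟨⟨S, hS⟩, fun x => ?_, fun fs f h g => ?_⟩
  · exact exists_linftyPairing_eq
      { toFun := fun f => Kc f x
        map_add' := fun f₁ f₂ => by rw [hadd]; rfl
        map_smul' := fun c f => by rw [hsmul]; rfl }
      fun fs f hb h => hsf fs f hb h x
  · simpa only [hS] using h (S g)
end

section
/- For every n ∈ ℕ, the map z ↦ μ_n(z) from ∂Ω_n to the finite positive measures on Ω_n is σ(ℳ(Ω_n), C_b(Ω_n))-continuous; that is, for every bounded continuous function f : Ω_n → ℝ the map z ↦ ∫_{Ω_n} f dμ_n(z) is continuous on ∂Ω_n. Moreover, every μ_n(z) is a positive measure with 0 ≤ μ_n(z, Ω_n) ≤ 1, and μ_n(z) ≤ μ_{n+1}(z) for every z ∈ ∂Ω_n ∩ ∂Ω_{n+1}. -/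
open MeasureTheory Filter Topology

/-- The approximating boundary measures `μₙ`: for `z ∈ ∂Ωₙ ∩ ∂Ω`,
`μₙ(z, A) = ρₙ(z) ∫_A ρₙ(x) μ(z, dx)` (a measure on `Ωₙ = Ω ∩ B_{n+1}(0)`), and
`μₙ(z, ·) = 0` for `z ∈ ∂Ωₙ \ ∂Ω`. -/
noncomputable def muApprox {d : ℕ} (Ω : Set (EuclideanSpace ℝ (Fin d)))
    (μ : EuclideanSpace ℝ (Fin d) → MeasureTheory.Measure (EuclideanSpace ℝ (Fin d)))
    (ρ : ℕ → EuclideanSpace ℝ (Fin d) → ℝ) (n : ℕ) (z : EuclideanSpace ℝ (Fin d)) :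
    MeasureTheory.Measure (EuclideanSpace ℝ (Fin d)) :=
  open scoped Classical in
  if z ∈ frontier Ω then
    ENNReal.ofReal (ρ n z) •
      (((μ z).restrict (Ω ∩ Metric.ball (0 : EuclideanSpace ℝ (Fin d)) (n + 1))).withDensity
        fun x => ENNReal.ofReal (ρ n x))
  else 0

/-- If `r` is continuous, nonnegative and vanishes off the open set `U`, and `f` is bounded and
continuous on `s ∩ U`, then `r * f`, extended by zero off `U`, is continuous on `s`. -/
theorem continuousOn_indicator_mul_of_eq_zero {X : Type*} [TopologicalSpace X] {s U : Set X}
    (hU : IsOpen U) {r f : X → ℝ} (hr : Continuous r) (hr0 : ∀ x, 0 ≤ r x)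
    (hrU : ∀ x, x ∉ U → r x = 0) (hf : ContinuousOn f (s ∩ U)) {C : ℝ}
    (hC : ∀ x ∈ s ∩ U, |f x| ≤ C) :
    ContinuousOn (U.indicator fun x => r x * f x) s := by
  intro x hx
  by_cases hxU : x ∈ U
  · have h : ContinuousWithinAt (fun x => r x * f x) (s ∩ U) x :=
      hr.continuousWithinAt.mul (hf x ⟨hx, hxU⟩)
    rw [continuousWithinAt_inter (hU.mem_nhds hxU)] at h
    refine h.congr_of_eventuallyEq ?_ (Set.indicator_of_mem hxU _)
    filter_upwards [mem_nhdsWithin_of_mem_nhds (hU.mem_nhds hxU)] with y hy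
    exact Set.indicator_of_mem hy _
  · have h0 : Tendsto (fun y => r y * C) (𝓝[s] x) (𝓝 0) := by
      have h := (hr.mul_const C).continuousWithinAt (s := s) (x := x)
      simpa [ContinuousWithinAt, hrU x hxU] using h
    rw [ContinuousWithinAt, Set.indicator_of_notMem hxU]
    refine squeeze_zero_norm' ?_ h0
    filter_upwards [self_mem_nhdsWithin] with y hy
    by_cases hyU : y ∈ U
    · rw [Set.indicator_of_mem hyU, norm_mul, Real.norm_eq_abs, Real.norm_eq_abs,
        abs_of_nonneg (hr0 y)]
      exact mul_le_mul_of_nonneg_left (hC y ⟨hy, hyU⟩) (hr0 y)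
    · simp [hyU, hrU y hyU]

/-- If `r` is continuous, nonnegative and vanishes off the open set `U`, and `h` is bounded and
continuous on the frontier of `s`, then `r * h`, extended by zero off the frontier of `s`, is
continuous on the frontier of `s ∩ U`. -/
theorem continuousOn_frontier_inter_mul_indicator {X : Type*} [TopologicalSpace X] {s U : Set X}
    (hU : IsOpen U) {r h : X → ℝ} (hr : Continuous r) (hr0 : ∀ x, 0 ≤ r x)
    (hrU : ∀ x, x ∉ U → r x = 0) (hh : ContinuousOn h (frontier s)) {C : ℝ}
    (hC : ∀ x ∈ frontier s, |h x| ≤ C) :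
    ContinuousOn (fun x => r x * (frontier s).indicator h x) (frontier (s ∩ U)) := by
  have hsub : frontier (s ∩ U) ∩ U ⊆ frontier s := by
    rw [frontier_inter_open_inter hU]
    exact Set.inter_subset_left
  intro x hx
  by_cases hxU : x ∈ U
  · rw [← continuousWithinAt_inter (hU.mem_nhds hxU)]
    have hcont : ContinuousWithinAt (fun x => r x * h x) (frontier (s ∩ U) ∩ U) x :=
      hr.continuousWithinAt.mul ((hh x (hsub ⟨hx, hxU⟩)).mono hsub)
    exact hcont.congr (fun y hy => by rw [Set.indicator_of_mem (hsub hy)])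
      (by rw [Set.indicator_of_mem (hsub ⟨hx, hxU⟩)])
  · have h0 : Tendsto (fun y => r y * |C|) (𝓝[frontier (s ∩ U)] x) (𝓝 0) := by
      have h := (hr.mul_const |C|).continuousWithinAt (s := frontier (s ∩ U)) (x := x)
      simpa [ContinuousWithinAt, hrU x hxU] using h
    rw [ContinuousWithinAt, hrU x hxU, zero_mul]
    refine squeeze_zero_norm (fun y => ?_) h0
    rw [norm_mul, Real.norm_eq_abs, Real.norm_eq_abs, abs_of_nonneg (hr0 y)]
    refine mul_le_mul_of_nonneg_left ?_ (hr0 y)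
    by_cases hy : y ∈ frontier s
    · rw [Set.indicator_of_mem hy]
      exact (hC y hy).trans (le_abs_self C)
    · simp [hy]

/-- Integrals against `muApprox` in terms of integrals against the boundary measures `μ`. -/
theorem setIntegral_muApprox {d : ℕ} {Ω : Set (EuclideanSpace ℝ (Fin d))} (hΩ : IsOpen Ω)
    (μ : EuclideanSpace ℝ (Fin d) → Measure (EuclideanSpace ℝ (Fin d)))
    {ρ : ℕ → EuclideanSpace ℝ (Fin d) → ℝ} {n : ℕ} (hρ : Continuous (ρ n))
    (hρ0 : ∀ x, 0 ≤ ρ n x) (f : EuclideanSpace ℝ (Fin d) → ℝ) (z : EuclideanSpace ℝ (Fin d)) :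
    ∫ x in Ω ∩ Metric.ball (0 : EuclideanSpace ℝ (Fin d)) (n + 1), f x ∂(muApprox Ω μ ρ n z) =
      ρ n z * (frontier Ω).indicator (fun z => ∫ x in Ω,
        (Metric.ball (0 : EuclideanSpace ℝ (Fin d)) (n + 1)).indicator
          (fun x => ρ n x * f x) x ∂(μ z)) z := by
  by_cases hz : z ∈ frontier Ω
  · have hm : MeasurableSet (Ω ∩ Metric.ball (0 : EuclideanSpace ℝ (Fin d)) (n + 1)) :=
      (hΩ.inter Metric.isOpen_ball).measurableSet
    rw [muApprox, if_pos hz, Set.indicator_of_mem hz,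
      setIntegral_indicator Metric.isOpen_ball.measurableSet, Measure.restrict_smul,
      integral_smul_measure, restrict_withDensity hm, Measure.restrict_restrict hm, Set.inter_self,
      integral_withDensity_eq_integral_toReal_smul hρ.measurable.ennreal_ofReal
        (ae_of_all _ fun _ => ENNReal.ofReal_lt_top)]
    simp [ENNReal.toReal_ofReal, hρ0]
  · simp [muApprox, hz]

/-- Let `Ω ⊆ ℝ^d` be nonempty and open, `μ : ∂Ω → ℳ(Ω)` a weakly
continuous family of Borel probability measures on `Ω`, `Ωₙ := Ω ∩ B_{n+1}(0)`, and
`ρₙ ∈ C(ℝ^d)` with `1_{Bₙ(0)} ≤ ρₙ ≤ 1_{B_{n+1}(0)}`. Then for every `n`: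
(a) each `μₙ(z)` is a positive measure with `0 ≤ μₙ(z, Ωₙ) ≤ 1`;
(b) `z ↦ μₙ(z)` is `σ(ℳ(Ωₙ), C_b(Ωₙ))`-continuous on `∂Ωₙ`, i.e. for every bounded
continuous `f : Ωₙ → ℝ` the map `z ↦ ∫_{Ωₙ} f dμₙ(z)` is continuous on `∂Ωₙ`;
(c) `μₙ(z) ≤ μₙ₊₁(z)` for every `z ∈ ∂Ωₙ ∩ ∂Ωₙ₊₁`. -/
theorem muApprox_properties {d : ℕ}
    (Ω : Set (EuclideanSpace ℝ (Fin d))) (hΩopen : IsOpen Ω) (hΩne : Ω.Nonempty)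
    (μ : EuclideanSpace ℝ (Fin d) → MeasureTheory.Measure (EuclideanSpace ℝ (Fin d)))
    (hμprob : ∀ z ∈ frontier Ω, μ z Ω = 1 ∧ μ z Ωᶜ = 0)
    (hμcont : ∀ f : EuclideanSpace ℝ (Fin d) → ℝ, ContinuousOn f Ω →
      (∃ C : ℝ, ∀ x ∈ Ω, |f x| ≤ C) →
      ContinuousOn (fun z => ∫ x in Ω, f x ∂(μ z)) (frontier Ω))
    (ρ : ℕ → EuclideanSpace ℝ (Fin d) → ℝ)
    (hρcont : ∀ n, Continuous (ρ n))
    (hρ : ∀ (n : ℕ) (x : EuclideanSpace ℝ (Fin d)),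
      (Metric.ball (0 : EuclideanSpace ℝ (Fin d)) n).indicator (fun _ => (1:ℝ)) x ≤ ρ n x ∧
      ρ n x ≤ (Metric.ball (0 : EuclideanSpace ℝ (Fin d)) (n + 1)).indicator
        (fun _ => (1:ℝ)) x)
    (n : ℕ) :
    (∀ z ∈ frontier (Ω ∩ Metric.ball (0 : EuclideanSpace ℝ (Fin d)) (n + 1)),
      muApprox Ω μ ρ n z (Ω ∩ Metric.ball (0 : EuclideanSpace ℝ (Fin d)) (n + 1)) ≤ 1) ∧
    (∀ f : EuclideanSpace ℝ (Fin d) → ℝ,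
      ContinuousOn f (Ω ∩ Metric.ball (0 : EuclideanSpace ℝ (Fin d)) (n + 1)) →
      (∃ C : ℝ, ∀ x ∈ Ω ∩ Metric.ball (0 : EuclideanSpace ℝ (Fin d)) (n + 1), |f x| ≤ C) →
      ContinuousOn
        (fun z => ∫ x in Ω ∩ Metric.ball (0 : EuclideanSpace ℝ (Fin d)) (n + 1),
          f x ∂(muApprox Ω μ ρ n z))
        (frontier (Ω ∩ Metric.ball (0 : EuclideanSpace ℝ (Fin d)) (n + 1)))) ∧
    (∀ z ∈ frontier (Ω ∩ Metric.ball (0 : EuclideanSpace ℝ (Fin d)) (n + 1)) ∩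
        frontier (Ω ∩ Metric.ball (0 : EuclideanSpace ℝ (Fin d)) (n + 2)),
      ∀ A : Set (EuclideanSpace ℝ (Fin d)), MeasurableSet A →
        A ⊆ Ω ∩ Metric.ball (0 : EuclideanSpace ℝ (Fin d)) (n + 1) →
        muApprox Ω μ ρ n z A ≤ muApprox Ω μ ρ (n + 1) z A) := by
  have hρ0 : ∀ k x, 0 ≤ ρ k x := fun k x =>
    (Set.indicator_nonneg (fun _ _ => zero_le_one) x).trans (hρ k x).1
  have hρ1 : ∀ k x, ρ k x ≤ 1 := fun k x =>
    (hρ k x).2.trans (Set.indicator_le_self' (fun _ _ => zero_le_one) x)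
  have hρU : ∀ x, x ∉ Metric.ball (0 : EuclideanSpace ℝ (Fin d)) (n + 1) → ρ n x = 0 :=
    fun x hx => le_antisymm ((hρ n x).2.trans_eq (Set.indicator_of_notMem hx _)) (hρ0 n x)
  have hρmono : ∀ x, ρ n x ≤ ρ (n + 1) x := fun x => by
    have h := (hρ (n + 1) x).1
    rw [Nat.cast_add_one] at h
    exact (hρ n x).2.trans h
  refine ⟨fun z _ => ?_, fun f hf ⟨C, hC⟩ => ?_, fun z _ A hA hAsub => ?_⟩
  · by_cases hz : z ∈ frontier Ω
    · have hm : MeasurableSet (Ω ∩ Metric.ball (0 : EuclideanSpace ℝ (Fin d)) (n + 1)) :=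
        (hΩopen.inter Metric.isOpen_ball).measurableSet
      rw [muApprox, if_pos hz, Measure.smul_apply, smul_eq_mul, withDensity_apply _ hm,
        Measure.restrict_restrict hm, Set.inter_self]
      refine mul_le_one' (ENNReal.ofReal_le_one.2 (hρ1 n z)) ?_
      calc ∫⁻ x in Ω ∩ Metric.ball 0 (n + 1), ENNReal.ofReal (ρ n x) ∂(μ z)
          ≤ ∫⁻ _ in Ω ∩ Metric.ball 0 (n + 1), 1 ∂(μ z) :=
            lintegral_mono fun x => ENNReal.ofReal_le_one.2 (hρ1 n x)
        _ = μ z (Ω ∩ Metric.ball 0 (n + 1)) := setLIntegral_one _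
        _ ≤ μ z Ω := measure_mono Set.inter_subset_left
        _ = 1 := (hμprob z hz).1
    · simp [muApprox, hz]
  · simp only [setIntegral_muApprox hΩopen μ (hρcont n) (hρ0 n)]
    have hbound : ∀ x ∈ Ω, |(Metric.ball (0 : EuclideanSpace ℝ (Fin d)) (n + 1)).indicator
        (fun x => ρ n x * f x) x| ≤ |C| := fun x hx => by
      by_cases hxU : x ∈ Metric.ball (0 : EuclideanSpace ℝ (Fin d)) (n + 1)
      · rw [Set.indicator_of_mem hxU, abs_mul, abs_of_nonneg (hρ0 n x)]
        exact (mul_le_of_le_one_left (abs_nonneg _) (hρ1 n x)).trans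
          ((hC x ⟨hx, hxU⟩).trans (le_abs_self C))
      · rw [Set.indicator_of_notMem hxU, abs_zero]
        exact abs_nonneg C
    refine continuousOn_frontier_inter_mul_indicator Metric.isOpen_ball (hρcont n) (hρ0 n) hρU
      (hμcont _ (continuousOn_indicator_mul_of_eq_zero Metric.isOpen_ball (hρcont n) (hρ0 n) hρU
        hf hC) ⟨|C|, hbound⟩) (C := |C|) fun z hz => ?_
    have h := norm_setIntegral_le_of_norm_le_const (μ := μ z)
      (f := (Metric.ball (0 : EuclideanSpace ℝ (Fin d)) (n + 1)).indicator fun x => ρ n x * f x)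
      (by rw [(hμprob z hz).1]; exact ENNReal.one_lt_top) hbound
    simpa [Measure.real, (hμprob z hz).1] using h
  · by_cases hz : z ∈ frontier Ω
    · simp only [muApprox, if_pos hz, Measure.smul_apply, smul_eq_mul]
      rw [withDensity_apply _ hA, withDensity_apply _ hA]
      refine mul_le_mul' (ENNReal.ofReal_le_ofReal (hρmono z)) (lintegral_mono' ?_ fun x =>
        ENNReal.ofReal_le_ofReal (hρmono x))
      refine Measure.restrict_mono subset_rfl (Measure.restrict_mono ?_ le_rfl)
      refine Set.inter_subset_inter_right _ (Metric.ball_subset_ball ?_)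
      push_cast
      linarith
    · simp [muApprox, hz]
end
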